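/- arXiv:2106.08907 — 2 statements merged into one kernel-verified Lean document; each statement's English description precedes it below -/
import Mathlib

section
/- Let γ be a Jordan curve on the unit sphere S² in ℝ³ and let ε > 0. Then there exists δ > 0 such that for every Jordan curve η on S² contained in the closed δ-neighborhood of γ, there is a continuous map φ : η → γ such that for all x ∈ η, ‖φ(x) − x‖ < ε. (The map φ need not be bijective.) -/
open Metric

/-- The unit circle in the Euclidean plane. -/
abbrev unitCircle : Set (EuclideanSpace ℝ (Fin 2)) :=
  Metric.sphere (0 : EuclideanSpace ℝ (Fin 2)) 1

/-- The unit 2-sphere in ℝ³. -/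
abbrev unitSphere2 : Set (EuclideanSpace ℝ (Fin 3)) :=
  Metric.sphere (0 : EuclideanSpace ℝ (Fin 3)) 1

/-- A Jordan curve on the unit 2-sphere: the image of a continuous injective map
from the unit circle into the sphere. -/
def IsJordanCurveOnS2 (γ : Set (EuclideanSpace ℝ (Fin 3))) : Prop :=
  γ ⊆ unitSphere2 ∧
  ∃ f : unitCircle → EuclideanSpace ℝ (Fin 3),
    Continuous f ∧ Function.Injective f ∧ Set.range f = γ

theorem nearby_jordan_curve_has_close_map
    (γ : Set (EuclideanSpace ℝ (Fin 3))) (hγ : IsJordanCurveOnS2 γ)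
    (ε : ℝ) (hε : 0 < ε) :
    ∃ δ > 0, ∀ η : Set (EuclideanSpace ℝ (Fin 3)), IsJordanCurveOnS2 η →
      (∀ x ∈ η, Metric.infDist x γ ≤ δ) →
      ∃ φ : EuclideanSpace ℝ (Fin 3) → EuclideanSpace ℝ (Fin 3),
        ContinuousOn φ η ∧ ∀ x ∈ η, φ x ∈ γ ∧ ‖φ x - x‖ < ε := by
  obtain ⟨_, f, hf, hinj, rfl⟩ := hγ
  have hcl : IsClosed unitCircle := Metric.isClosed_sphere
  have : CompactSpace unitCircle := isCompact_iff_compactSpace.mp (isCompact_sphere _ _)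
  have hemb : Topology.IsClosedEmbedding f := hf.isClosedEmbedding hinj
  have tz2 : TietzeExtension (EuclideanSpace ℝ (Fin 2)) := TietzeExtension.of_tvs ℝ
  have tz3 : TietzeExtension (EuclideanSpace ℝ (Fin 3)) := TietzeExtension.of_tvs ℝ
  obtain ⟨F, hF⟩ := ContinuousMap.exists_extension
    hcl.isClosedEmbedding_subtypeVal (⟨f, hf⟩ : C(unitCircle, EuclideanSpace ℝ (Fin 3)))
  obtain ⟨g, hg⟩ := ContinuousMap.exists_extension hemb
    (⟨Subtype.val, continuous_subtype_val⟩ : C(unitCircle, EuclideanSpace ℝ (Fin 2)))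
  have hF' : ∀ t : unitCircle, F t = f t := fun t => DFunLike.congr_fun hF t
  have hg' : ∀ t : unitCircle, g (f t) = t := fun t => DFunLike.congr_fun hg t
  set ψ : EuclideanSpace ℝ (Fin 3) → EuclideanSpace ℝ (Fin 3) :=
    fun x => F (‖g x‖⁻¹ • g x) with hψ
  set V : Set (EuclideanSpace ℝ (Fin 3)) := {x | g x ≠ 0} with hV
  have hVo : IsOpen V := isOpen_ne_fun g.continuous continuous_const
  have hψc : ContinuousOn ψ V := by
    apply F.continuous.comp_continuousOn
    refine ContinuousOn.smul (f := fun x => ‖g x‖⁻¹) (g := fun x => g x) ?_ ?_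
    · exact ContinuousOn.inv₀ g.continuous.norm.continuousOn
        (fun x hx => norm_ne_zero_iff.mpr hx)
    · exact g.continuous.continuousOn
  have hUo : IsOpen (V ∩ (fun x => ‖ψ x - x‖) ⁻¹' Set.Iio ε) :=
    (hψc.sub continuousOn_id).norm.isOpen_inter_preimage hVo isOpen_Iio
  have hsub : Set.range f ⊆ V ∩ (fun x => ‖ψ x - x‖) ⁻¹' Set.Iio ε := by
    rintro _ ⟨t, rfl⟩
    have ht : ‖(t : EuclideanSpace ℝ (Fin 2))‖ = 1 := by simpa using t.2
    refine ⟨?_, ?_⟩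
    · simp only [hV, Set.mem_setOf_eq, hg']
      rw [← norm_ne_zero_iff, ht]
      exact one_ne_zero
    · simp only [hψ, Set.mem_preimage, Set.mem_Iio, hg', ht, inv_one, one_smul, hF', sub_self,
        norm_zero]
      exact hε
  obtain ⟨δ, hδ, hsubδ⟩ := (isCompact_range hf).exists_cthickening_subset_open hUo hsub
  have hne : (Set.range f).Nonempty := by
    obtain ⟨v, hv⟩ := (NormedSpace.sphere_nonempty
      (E := EuclideanSpace ℝ (Fin 2)) (x := 0) (r := 1)).mpr zero_le_one
    exact ⟨f ⟨v, hv⟩, Set.mem_range_self _⟩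
  refine ⟨δ, hδ, fun η _ hη => ⟨ψ, ?_, ?_⟩⟩
  all_goals
    have key : η ⊆ V ∩ (fun x => ‖ψ x - x‖) ⁻¹' Set.Iio ε := fun x hx =>
      hsubδ (by
        obtain ⟨y, hy, hxy⟩ := (isCompact_range hf).exists_infDist_eq_dist hne x
        exact Metric.mem_cthickening_of_dist_le x y δ _ hy (hxy ▸ hη x hx))
  · exact hψc.mono fun x hx => (key hx).1
  · intro x hx
    refine ⟨?_, (key hx).2⟩
    have hx0 : g x ≠ 0 := (key hx).1
    have hm : ‖g x‖⁻¹ • g x ∈ unitCircle := by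
      simp [norm_smul, hx0]
    exact ⟨⟨_, hm⟩, (hF' ⟨_, hm⟩).symm⟩
end

section
/- Let ψ : ℝ → ℝ be continuous and satisfy ψ(θ + 2π) = ψ(θ) + 2π for all θ ∈ ℝ. If ψ is not weakly increasing (i.e., there exist w₀ < y₀ with ψ(y₀) < ψ(w₀)), then there exist real numbers v < w < x < y < z such that ψ(v) = ψ(y) < ψ(x) < ψ(w) = ψ(z). -/
open Real

theorem exists_five_points_of_not_monotone_lift
    (ψ : ℝ → ℝ) (hc : Continuous ψ)
    (hper : ∀ θ : ℝ, ψ (θ + 2 * π) = ψ θ + 2 * π)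
    (hnot : ∃ w₀ y₀ : ℝ, w₀ < y₀ ∧ ψ y₀ < ψ w₀) :
    ∃ v w x y z : ℝ, v < w ∧ w < x ∧ x < y ∧ y < z ∧
      ψ v = ψ y ∧ ψ y < ψ x ∧ ψ x < ψ w ∧ ψ w = ψ z := by
  obtain ⟨w, y, hwy, hlt⟩ := hnot
  have hpi : (0 : ℝ) < 2 * π := by positivity
  have hn : ∀ (n : ℕ) (θ : ℝ), ψ (θ + n * (2 * π)) = ψ θ + n * (2 * π) := by
    intro n
    induction n with
    | zero => intro θ; simp
    | succ k ih =>
      intro θ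
      have h := hper (θ + k * (2 * π))
      rw [ih] at h
      push_cast
      rw [show θ + ((k : ℝ) + 1) * (2 * π) = θ + k * (2 * π) + 2 * π by ring, h]
      ring
  obtain ⟨n, hnn⟩ := exists_nat_gt ((ψ w - ψ y) / (2 * π))
  rw [div_lt_iff₀ hpi] at hnn
  have hpos : 0 < (n : ℝ) * (2 * π) := by linarith
  have h1 := hn n (w - n * (2 * π))
  rw [sub_add_cancel] at h1
  have h2 := hn n y
  obtain ⟨x, ⟨hx1, hx2⟩, hx⟩ := intermediate_value_Ioo' hwy.le hc.continuousOn
    (show (ψ w + ψ y) / 2 ∈ Set.Ioo (ψ y) (ψ w) by constructor <;> linarith)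
  obtain ⟨v, ⟨hv1, hv2⟩, hv⟩ := intermediate_value_Ioo
    (show w - n * (2 * π) ≤ w by linarith) hc.continuousOn
    (show ψ y ∈ Set.Ioo (ψ (w - n * (2 * π))) (ψ w) by constructor <;> linarith)
  obtain ⟨z, ⟨hz1, hz2⟩, hz⟩ := intermediate_value_Ioo
    (show y ≤ y + n * (2 * π) by linarith) hc.continuousOn
    (show ψ w ∈ Set.Ioo (ψ y) (ψ (y + n * (2 * π))) by constructor <;> linarith)
  exact ⟨v, w, x, y, z, hv2, hx1, hx2, hz1, hv, by linarith, by linarith, hz.symm⟩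
end
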